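/- Let 𝕋 be a non-degenerate hyperaffine algebraic theory, B = T(2) its Boolean algebra, and 𝒥 its zero-dimensional topology of realised partitions. Then the maps T(I) → T_{B_𝒥}(I), t ↦ (λi. t^{(i)}), are well-defined bijections which preserve projections and substitution, and hence constitute an isomorphism of algebraic theories 𝕋 ≅ 𝕋_{B_𝒥}. -/

import Mathlib

/-- An (infinitary) algebraic theory. -/
structure AlgTheory where
  T : Type → Type
  pr : ∀ {I : Type}, I → T I
  subst : ∀ {I J : Type}, T I → (I → T J) → T J
  subst_pr : ∀ {I : Type} (t : T I), subst t (fun i => pr i) = t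
  pr_subst : ∀ {I J : Type} (i : I) (u : I → T J), subst (pr i) u = u i
  subst_assoc : ∀ {I J K : Type} (t : T I) (u : I → T J) (v : J → T K),
      subst (subst t u) v = subst t (fun i => subst (u i) v)

def AlgTheory.IsAffine (𝕋 : AlgTheory) {I : Type} (t : 𝕋.T I) : Prop :=
  𝕋.subst t (fun _ => 𝕋.pr PUnit.unit) = 𝕋.pr PUnit.unit

def AlgTheory.IsHyperaffine (𝕋 : AlgTheory) {I : Type} (t : 𝕋.T I) : Prop :=
  𝕋.IsAffine t ∧
  𝕋.subst t (fun i => 𝕋.subst t (fun j => 𝕋.pr (i, j))) =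
    𝕋.subst t (fun i => 𝕋.pr (i, i))

def AlgTheory.sub2 (𝕋 : AlgTheory) (b c d : 𝕋.T Bool) : 𝕋.T Bool :=
  𝕋.subst b (fun i => if i then c else d)

-- The binary reduct `t^{(U)} ∈ T 2` of `t ∈ T I` along `U ⊆ I`.
open Classical in
noncomputable def AlgTheory.reduct (𝕋 : AlgTheory) {I : Type} (t : 𝕋.T I) (U : Set I) :
    𝕋.T Bool :=
  𝕋.subst t (fun i => if i ∈ U then 𝕋.pr true else 𝕋.pr false)

/-- The operation `h ∈ T I` realises `P ⊆ B = T 2` when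
`P = {h^{(i)} : i ∈ I} \ {0}`. -/
def Realises (𝕋 : AlgTheory) [BooleanAlgebra (𝕋.T Bool)] {I : Type}
    (h : 𝕋.T I) (P : Set (𝕋.T Bool)) : Prop :=
  P = Set.range (fun i => 𝕋.reduct h {i}) \ {⊥}

/-- `ω : I → B` is a `B_𝒥`-valued distribution (w.r.t. a collection `J` of
subsets of `B`): its restriction to its support is injective with image in `J`. -/
def IsDistribOn {B : Type} [BooleanAlgebra B] (J : Set (Set B)) {I : Type}
    (ω : I → B) : Prop :=
  Set.InjOn ω {i | ω i ≠ ⊥} ∧ ω '' {i | ω i ≠ ⊥} ∈ J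

namespace AlgTheory

variable {𝕋 : AlgTheory} {I J : Type}

lemma IsHyperaffine.subst_const {t : 𝕋.T I} (ht : 𝕋.IsHyperaffine t) (x : 𝕋.T J) :
    𝕋.subst t (fun _ => x) = x := by
  have h := congrArg (fun s => 𝕋.subst s (fun _ => x)) ht.1
  simpa only [𝕋.subst_assoc, 𝕋.pr_subst] using h

lemma IsHyperaffine.subst_diag {t : 𝕋.T I} (ht : 𝕋.IsHyperaffine t) (v : I → I → 𝕋.T J) :
    𝕋.subst t (fun i => 𝕋.subst t (v i)) = 𝕋.subst t (fun i => v i i) := by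
  have h := congrArg (fun s => 𝕋.subst s (fun p => v p.1 p.2)) ht.2
  simpa only [𝕋.subst_assoc, 𝕋.pr_subst] using h

lemma subst_reduct (t : 𝕋.T I) (U : Set I) [∀ i, Decidable (i ∈ U)] (x y : 𝕋.T J) :
    𝕋.subst (𝕋.reduct t U) (fun b => if b then x else y) =
      𝕋.subst t (fun i => if i ∈ U then x else y) := by
  rw [reduct, 𝕋.subst_assoc]
  congr 1
  funext i
  by_cases hi : i ∈ U <;> simp [𝕋.pr_subst, hi]

lemma sub2_pr_true_pr_false (b : 𝕋.T Bool) :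
    𝕋.sub2 b (𝕋.pr true) (𝕋.pr false) = b := by
  have h : (fun i : Bool => if i then 𝕋.pr true else 𝕋.pr false) =
      fun i => (𝕋.pr i : 𝕋.T Bool) := by
    funext i; cases i <;> simp
  rw [sub2, h, 𝕋.subst_pr]

lemma sub2_pr_false (c d : 𝕋.T Bool) : 𝕋.sub2 (𝕋.pr false) c d = d := by
  simp [sub2, 𝕋.pr_subst]

lemma reduct_subst (t : 𝕋.T I) (u : I → 𝕋.T J) (U : Set J) :
    𝕋.reduct (𝕋.subst t u) U = 𝕋.subst t (fun i => 𝕋.reduct (u i) U) :=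
  𝕋.subst_assoc _ _ _

lemma reduct_pr_of_mem {i : I} {U : Set I} (h : i ∈ U) :
    𝕋.reduct (𝕋.pr i) U = 𝕋.pr true := by
  simp [reduct, 𝕋.pr_subst, h]

lemma reduct_pr_of_notMem {i : I} {U : Set I} (h : i ∉ U) :
    𝕋.reduct (𝕋.pr i) U = 𝕋.pr false := by
  simp [reduct, 𝕋.pr_subst, h]

lemma IsHyperaffine.reduct_empty {t : 𝕋.T I} (ht : 𝕋.IsHyperaffine t) :
    𝕋.reduct t ∅ = 𝕋.pr false := by
  simp [reduct, ht.subst_const]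

/-- Under `t`, each argument may be restricted to the corresponding block of `t`. -/
lemma IsHyperaffine.subst_sub2_reduct_singleton {t : 𝕋.T I} (ht : 𝕋.IsHyperaffine t)
    (x : I → 𝕋.T Bool) (y : 𝕋.T Bool) :
    𝕋.subst t (fun i => 𝕋.sub2 (𝕋.reduct t {i}) (x i) y) = 𝕋.subst t x := by
  classical
  simp only [sub2, subst_reduct]
  rw [ht.subst_diag]
  simp

lemma IsHyperaffine.subst_reduct_singleton {t : 𝕋.T I} (ht : 𝕋.IsHyperaffine t) :
    𝕋.subst t (fun i => 𝕋.reduct t {i}) = 𝕋.pr true := by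
  have h := ht.subst_sub2_reduct_singleton (fun _ => 𝕋.pr true) (𝕋.pr false)
  simpa only [sub2_pr_true_pr_false, ht.subst_const] using h

lemma IsHyperaffine.exists_reduct_singleton_ne {t : 𝕋.T I} (ht : 𝕋.IsHyperaffine t)
    (nondeg : (𝕋.pr true : 𝕋.T Bool) ≠ 𝕋.pr false) :
    ∃ i, 𝕋.reduct t {i} ≠ 𝕋.pr false := by
  by_contra! h
  have h1 := ht.subst_reduct_singleton
  simp only [h, ht.subst_const] at h1
  exact nondeg h1.symm

lemma IsHyperaffine.reduct_congr {t : 𝕋.T I} (ht : 𝕋.IsHyperaffine t) {U V : Set I}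
    (h : ∀ i, 𝕋.reduct t {i} ≠ 𝕋.pr false → (i ∈ U ↔ i ∈ V)) :
    𝕋.reduct t U = 𝕋.reduct t V := by
  classical
  unfold reduct
  rw [← ht.subst_sub2_reduct_singleton _ (𝕋.pr false),
    ← ht.subst_sub2_reduct_singleton (fun i => if i ∈ V then _ else _) (𝕋.pr false)]
  congr 1
  funext i
  by_cases hi : 𝕋.reduct t {i} = 𝕋.pr false
  · rw [hi, sub2_pr_false, sub2_pr_false]
  · simp [h i hi]

lemma IsHyperaffine.sub2_reduct_subst {t : 𝕋.T I} (ht : 𝕋.IsHyperaffine t) (i : I)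
    (b : I → 𝕋.T Bool) (c : 𝕋.T Bool) :
    𝕋.sub2 (𝕋.reduct t {i}) (𝕋.subst t b) c = 𝕋.sub2 (𝕋.reduct t {i}) (b i) c := by
  classical
  have h : (fun k => if k ∈ ({i} : Set I) then 𝕋.subst t b else c) =
      fun k => 𝕋.subst t (fun l => if k ∈ ({i} : Set I) then b l else c) := by
    funext k
    split_ifs
    · rfl
    · rw [ht.subst_const]
  simp only [sub2, subst_reduct]
  rw [h, ht.subst_diag]
  congr 1
  funext k
  by_cases hk : k = i <;> simp [hk]

lemma IsHyperaffine.sub2_reduct_reduct_of_ne {t : 𝕋.T I} (ht : 𝕋.IsHyperaffine t) {i j : I}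
    (hij : i ≠ j) :
    𝕋.sub2 (𝕋.reduct t {i}) (𝕋.reduct t {j}) (𝕋.pr false) = 𝕋.pr false := by
  rw [show 𝕋.reduct t {j} = 𝕋.subst t _ from rfl, ht.sub2_reduct_subst,
    if_neg (by simpa using hij)]
  classical
  simpa [sub2, ht.subst_const] using
    subst_reduct t {i} (𝕋.pr false : 𝕋.T Bool) (𝕋.pr false)

/-- An operation on pairs whose mass lies on the diagonal has equal marginals. -/
lemma IsHyperaffine.subst_fst_eq_subst_snd {w : 𝕋.T (I × I)} (hw : 𝕋.IsHyperaffine w)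
    (hΔ : 𝕋.reduct w (Set.diagonal I) = 𝕋.pr true) :
    𝕋.subst w (fun p => 𝕋.pr p.1) = 𝕋.subst w (fun p => 𝕋.pr p.2) := by
  classical
  have h := subst_reduct w (Set.diagonal I) (𝕋.subst w (fun p => 𝕋.pr p.1))
    (𝕋.subst w (fun p => 𝕋.pr p.2))
  rw [hΔ, 𝕋.pr_subst, if_pos rfl] at h
  simp only [← apply_ite (𝕋.subst w)] at h
  rw [h, hw.subst_diag]
  congr 1
  funext p
  by_cases hp : p.1 = p.2 <;> simp [hp]

lemma eq_of_reduct_singleton_eq (hyp : ∀ (I : Type) (t : 𝕋.T I), 𝕋.IsHyperaffine t)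
    {t u : 𝕋.T I} (h : ∀ i, 𝕋.reduct t {i} = 𝕋.reduct u {i}) : t = u := by
  have hw : 𝕋.reduct (𝕋.subst t fun i => 𝕋.subst u fun j => 𝕋.pr (i, j)) (Set.diagonal I) =
      𝕋.pr true := by
    rw [← (hyp I t).subst_reduct_singleton, reduct_subst]
    congr 1
    funext i
    rw [reduct_subst, h, reduct]
    congr 1
    funext j
    by_cases hij : j = i
    · subst hij
      rw [reduct_pr_of_mem (by simp), if_pos (by simp)]
    · rw [reduct_pr_of_notMem (by simpa using Ne.symm hij), if_neg (by simpa using hij)]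
  have h := (hyp _ _).subst_fst_eq_subst_snd hw
  simpa only [𝕋.subst_assoc, 𝕋.pr_subst, (hyp I u).subst_const, (hyp I t).subst_const,
    𝕋.subst_pr] using h

end AlgTheory

open AlgTheory in
/-- For a non-degenerate hyperaffine theory `𝕋` with Boolean algebra `B = T 2`
and zero-dimensional topology `𝒥` of realised partitions, the maps
`t ↦ (λ i. t^{(i)})` are bijections from `T I` onto the `B_𝒥`-valued
distributions on `I`, preserving projections and substitution; hence they
constitute an isomorphism of algebraic theories `𝕋 ≅ 𝕋_{B_𝒥}`. -/
theorem theory_iso_distribution_theory (𝕋 : AlgTheory)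
    (nondeg : (𝕋.pr true : 𝕋.T Bool) ≠ 𝕋.pr false)
    (hyp : ∀ (I : Type) (t : 𝕋.T I), 𝕋.IsHyperaffine t)
    [BooleanAlgebra (𝕋.T Bool)]
    (htop : (⊤ : 𝕋.T Bool) = 𝕋.pr true)
    (hbot : (⊥ : 𝕋.T Bool) = 𝕋.pr false)
    (hinf : ∀ b c : 𝕋.T Bool,
      b ⊓ c = 𝕋.sub2 b (𝕋.sub2 c (𝕋.pr true) (𝕋.pr false)) (𝕋.pr false))
    (hsup : ∀ b c : 𝕋.T Bool,
      b ⊔ c = 𝕋.sub2 b (𝕋.pr true) (𝕋.sub2 c (𝕋.pr true) (𝕋.pr false)))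
    (hcompl : ∀ b : 𝕋.T Bool, bᶜ = 𝕋.sub2 b (𝕋.pr false) (𝕋.pr true)) :
    -- well-definedness: each `λ i. t^{(i)}` is a distribution
    (∀ (I : Type) (t : 𝕋.T I),
      IsDistribOn {P : Set (𝕋.T Bool) | ∃ (I' : Type) (h : 𝕋.T I'), Realises 𝕋 h P}
        (fun i => 𝕋.reduct t {i})) ∧
    -- injectivity
    (∀ (I : Type) (t u : 𝕋.T I),
      (fun i => 𝕋.reduct t {i}) = (fun i => 𝕋.reduct u {i}) → t = u) ∧
    -- surjectivity onto distributions
    (∀ (I : Type) (ω : I → 𝕋.T Bool),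
      IsDistribOn {P : Set (𝕋.T Bool) | ∃ (I' : Type) (h : 𝕋.T I'), Realises 𝕋 h P} ω →
      ∃ t : 𝕋.T I, (fun i => 𝕋.reduct t {i}) = ω) ∧
    -- preservation of projections
    (∀ (I : Type) (i j : I),
      (i = j → 𝕋.reduct (𝕋.pr i : 𝕋.T I) {j} = ⊤) ∧
      (j ≠ i → 𝕋.reduct (𝕋.pr i : 𝕋.T I) {j} = ⊥)) ∧
    -- preservation of substitution: `ω_{t(u)}(j) = ⨆_i ω_t(i) ⊓ ω_{u i}(j)`
    (∀ (I J : Type) (t : 𝕋.T I) (u : I → 𝕋.T J) (j : J),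
      IsLUB (Set.range fun i => 𝕋.reduct t {i} ⊓ 𝕋.reduct (u i) {j})
        (𝕋.reduct (𝕋.subst t u) {j})) := by
  have inf_eq (b c : 𝕋.T Bool) : b ⊓ c = 𝕋.sub2 b c (𝕋.pr false) := by
    rw [hinf, sub2_pr_true_pr_false]
  have injOn (I : Type) (t : 𝕋.T I) (i j : I) (hi : 𝕋.reduct t {i} ≠ ⊥)
      (hij : 𝕋.reduct t {i} = 𝕋.reduct t {j}) : i = j := by
    by_contra hne
    have h := (hyp I t).sub2_reduct_reduct_of_ne hne
    rw [← inf_eq, ← hij, inf_idem, ← hbot] at h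
    exact hi h
  refine ⟨fun I t => ⟨fun i hi j _ hij => injOn I t i j hi hij, I, t, ?_⟩, ?_, ?_, ?_, ?_⟩
  · ext b
    constructor
    · rintro ⟨i, hi, rfl⟩
      exact ⟨⟨i, rfl⟩, hi⟩
    · rintro ⟨⟨i, rfl⟩, hi⟩
      exact ⟨i, hi, rfl⟩
  · exact fun I t u h => eq_of_reduct_singleton_eq hyp (congrFun h)
  · rintro I ω ⟨hinj, I', h, hP⟩
    have key (i' : I') (hi' : 𝕋.reduct h {i'} ≠ ⊥) : ∃ i, ω i = 𝕋.reduct h {i'} := by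
      have hm : 𝕋.reduct h {i'} ∈ ω '' {i | ω i ≠ ⊥} := by
        rw [hP]
        exact ⟨⟨i', rfl⟩, hi'⟩
      obtain ⟨i, -, hi⟩ := hm
      exact ⟨i, hi⟩
    obtain ⟨i₀', hi₀'⟩ := (hyp I' h).exists_reduct_singleton_ne nondeg
    obtain ⟨i₀, -⟩ := key i₀' (by rwa [hbot])
    have key' (i' : I') : ∃ i, 𝕋.reduct h {i'} ≠ ⊥ → ω i = 𝕋.reduct h {i'} := by
      by_cases hi' : 𝕋.reduct h {i'} = ⊥
      · exact ⟨i₀, fun hn => absurd hi' hn⟩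
      · obtain ⟨i, hi⟩ := key i' hi'
        exact ⟨i, fun _ => hi⟩
    choose f hf using key'
    refine ⟨𝕋.subst h (fun i' => 𝕋.pr (f i')), funext fun i => ?_⟩
    have hpre : 𝕋.reduct (𝕋.subst h fun i' => 𝕋.pr (f i')) {i} = 𝕋.reduct h (f ⁻¹' {i}) := by
      simp only [reduct, 𝕋.subst_assoc, 𝕋.pr_subst]
      rfl
    change 𝕋.reduct (𝕋.subst h fun i' => 𝕋.pr (f i')) {i} = ω i
    rw [hpre]
    by_cases hi : ω i = ⊥
    · rw [hi, hbot, ← (hyp I' h).reduct_empty]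
      refine (hyp I' h).reduct_congr fun i' hi' => ?_
      rw [← hbot] at hi'
      simp only [Set.mem_preimage, Set.mem_singleton_iff, Set.mem_empty_iff_false, iff_false]
      rintro rfl
      exact hi' ((hf i' hi').symm.trans hi)
    · have hm : ω i ∈ Set.range (fun i' => 𝕋.reduct h {i'}) \ {⊥} := by
        rw [← hP]
        exact ⟨i, hi, rfl⟩
      obtain ⟨⟨i₁, hi₁⟩, -⟩ := hm
      rw [← hi₁]
      refine (hyp I' h).reduct_congr fun i' hi' => ?_
      rw [← hbot] at hi'
      simp only [Set.mem_preimage, Set.mem_singleton_iff]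
      constructor
      · rintro rfl
        exact injOn I' h _ _ hi' ((hf i' hi').symm.trans hi₁.symm)
      · rintro rfl
        have hfi := hf i' hi'
        exact hinj (by simpa [hfi] using hi') hi (hfi.trans hi₁)
  · refine fun I i j => ⟨fun hij => ?_, fun hij => ?_⟩
    · rw [htop, reduct_pr_of_mem (by simpa using hij)]
    · rw [hbot, reduct_pr_of_notMem (by simpa using hij.symm)]
  · intro I J t u j
    have ht := hyp I t
    rw [reduct_subst]
    constructor
    · rintro _ ⟨i, rfl⟩
      change 𝕋.reduct t {i} ⊓ 𝕋.reduct (u i) {j} ≤ _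
      have h := ht.sub2_reduct_subst i (fun i => 𝕋.reduct (u i) {j}) (𝕋.pr false)
      rw [inf_eq, ← h, ← inf_eq]
      exact inf_le_right
    · intro c hc
      have hc' (i : I) : 𝕋.reduct t {i} ⊓ 𝕋.reduct (u i) {j} =
          𝕋.reduct t {i} ⊓ (𝕋.reduct (u i) {j} ⊓ c) := by
        rw [← inf_assoc]
        exact (inf_eq_left.mpr (hc ⟨i, rfl⟩)).symm
      rw [← inf_eq_left]
      calc 𝕋.subst t (fun i => 𝕋.reduct (u i) {j}) ⊓ c
          = 𝕋.subst t (fun i => 𝕋.reduct (u i) {j} ⊓ c) := by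
            simp only [inf_eq, sub2, 𝕋.subst_assoc]
        _ = 𝕋.subst t (fun i => 𝕋.reduct t {i} ⊓ (𝕋.reduct (u i) {j} ⊓ c)) := by
            simp only [inf_eq, ht.subst_sub2_reduct_singleton]
        _ = 𝕋.subst t (fun i => 𝕋.reduct t {i} ⊓ 𝕋.reduct (u i) {j}) := by
            simp only [← hc']
        _ = 𝕋.subst t (fun i => 𝕋.reduct (u i) {j}) := by
            simp only [inf_eq, ht.subst_sub2_reduct_singleton]
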